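/- Let k ≥ 3 be odd. In the braid group B_k on k strands, let a = σ₂σ₄⋯σ_{k−1} (the product of the even-indexed generators) and b = σ₁σ₃⋯σ_{k−2} (the product of the odd-indexed generators). Then the alternating products with k factors on each side are equal: abab⋯a = baba⋯b (each side a product of k alternating factors, beginning with a and with b respectively). -/

import Mathlib

/-!
Braid group infrastructure.

`BraidGroup m` is the Artin braid group on `m` strands, presented with generators
`σ 0, …, σ (m-2)` (here `σ i` denotes the usual generator `σ_{i+1}`) and the braid
relations `σ i * σ j = σ j * σ i` for `|i - j| ≥ 2` and
`σ i * σ j * σ i = σ j * σ i * σ j` for `j = i + 1`.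
-/

/-- The braid relations on `m` strands (generators indexed by `Fin (m - 1)`). -/
def braidRels (m : ℕ) : Set (FreeGroup (Fin (m - 1))) :=
  { r | (∃ i j : Fin (m - 1), (i : ℕ) + 2 ≤ (j : ℕ) ∧
          r = FreeGroup.of i * FreeGroup.of j * (FreeGroup.of i)⁻¹ * (FreeGroup.of j)⁻¹) ∨
        (∃ i j : Fin (m - 1), (j : ℕ) = (i : ℕ) + 1 ∧
          r = FreeGroup.of i * FreeGroup.of j * FreeGroup.of i *
              (FreeGroup.of j * FreeGroup.of i * FreeGroup.of j)⁻¹) }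

/-- The braid group on `m` strands. -/
abbrev BraidGroup (m : ℕ) : Type := PresentedGroup (braidRels m)

/-- The braid generator `σ_{i+1}` of the braid group on `m` strands. -/
def σ {m : ℕ} (i : Fin (m - 1)) : BraidGroup m := PresentedGroup.of i

private lemma swap_commute {α : Type*} [DecidableEq α] {a b c d : α}
    (hac : a ≠ c) (had : a ≠ d) (hbc : b ≠ c) (hbd : b ≠ d) :
    Equiv.swap a b * Equiv.swap c d = Equiv.swap c d * Equiv.swap a b := by
  have h := (Equiv.swap_apply_apply (Equiv.swap a b) c d).symm
  rw [Equiv.swap_apply_of_ne_of_ne hac.symm hbc.symm,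
    Equiv.swap_apply_of_ne_of_ne had.symm hbd.symm] at h
  exact mul_inv_eq_iff_eq_mul.mp h

private lemma swap_braid {α : Type*} [DecidableEq α] {x y z : α}
    (hxy : x ≠ y) (hyz : y ≠ z) (hxz : x ≠ z) :
    Equiv.swap x y * Equiv.swap y z * Equiv.swap x y =
      Equiv.swap y z * Equiv.swap x y * Equiv.swap y z := by
  have h1 := (Equiv.swap_apply_apply (Equiv.swap x y) y z).symm
  rw [Equiv.swap_apply_right, Equiv.swap_apply_of_ne_of_ne hxz.symm hyz.symm] at h1
  have h2 := (Equiv.swap_apply_apply (Equiv.swap y z) x y).symm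
  rw [Equiv.swap_apply_of_ne_of_ne hxy hxz, Equiv.swap_apply_left] at h2
  rw [Equiv.swap_inv] at h1 h2
  calc Equiv.swap x y * Equiv.swap y z * Equiv.swap x y = Equiv.swap x z := h1
    _ = Equiv.swap y z * Equiv.swap x y * Equiv.swap y z := h2.symm

/-- The transposition `(i+1, i+2)`, as image of the braid generator `σ_{i+1}`. -/
def braidGen (m : ℕ) (i : Fin (m - 1)) : Equiv.Perm (Fin m) :=
  Equiv.swap ⟨i.1, by have := i.isLt; omega⟩ ⟨i.1 + 1, by have := i.isLt; omega⟩

private lemma braid_rels_hold (m : ℕ) :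
    ∀ r ∈ braidRels m, FreeGroup.lift (braidGen m) r = 1 := by
  rintro r (⟨i, j, hij, rfl⟩ | ⟨i, j, hij, rfl⟩) <;>
    simp only [map_mul, map_inv, FreeGroup.lift_apply_of]
  · rw [mul_inv_eq_one (a := _ * _ * _), mul_inv_eq_iff_eq_mul]
    unfold braidGen
    apply swap_commute <;> (simp only [ne_eq, Fin.mk.injEq]; omega)
  · obtain ⟨jv, hjlt⟩ := j
    simp only [Fin.val_mk] at hij
    subst hij
    rw [mul_inv_eq_one (a := _ * _ * _)]
    unfold braidGen
    simp only [Fin.val_mk]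
    apply swap_braid <;> (simp only [ne_eq, Fin.mk.injEq]; omega)

/-- The canonical surjection from the braid group on `m` strands to the symmetric
group on `m` letters, sending `σ_{i+1}` to the transposition `(i+1, i+2)`
(`0`-indexed: the swap of `i` and `i + 1` in `Fin m`). -/
def braidToPerm (m : ℕ) : BraidGroup m →* Equiv.Perm (Fin m) :=
  PresentedGroup.toGroup (braid_rels_hold m)
/-- `altProd x y n` is the alternating product `x * y * x * y * ⋯` with `n` factors. -/
def altProd {G : Type*} [Monoid G] (x y : G) : ℕ → G
  | 0 => 1
  | n + 1 => x * altProd y x n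

lemma altProd_add_two {G : Type*} [Monoid G] (x y : G) (n : ℕ) :
    altProd x y (n + 2) = x * y * altProd x y n := by
  simp [altProd, mul_assoc]

lemma altProd_two_mul {G : Type*} [Monoid G] (x y : G) (n : ℕ) :
    altProd x y (2 * n) = (x * y) ^ n := by
  induction n with
  | zero => simp [altProd]
  | succ m ih =>
    rw [show 2 * (m + 1) = 2 * m + 2 from by ring, altProd_add_two, ih, ← pow_succ']

lemma altProd_two_mul_add_one {G : Type*} [Monoid G] (x y : G) (n : ℕ) :
    altProd x y (2 * n + 1) = (x * y) ^ n * x := by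
  induction n with
  | zero => simp [altProd]
  | succ m ih =>
    rw [show 2 * (m + 1) + 1 = (2 * m + 1) + 2 from by ring, altProd_add_two, ih,
      ← mul_assoc, ← pow_succ']

/-- In a group, if `s` and `t` are involutions and `(s * t) ^ k = 1`, then the two
alternating products of `s` and `t` with `k` factors agree. -/
lemma altProd_swap_eq {G : Type*} [Group G] {s t : G} (hs : s * s = 1) (ht : t * t = 1)
    {k : ℕ} (h : (s * t) ^ k = 1) : altProd s t k = altProd t s k := by
  have hs' : s⁻¹ = s := inv_eq_of_mul_eq_one_right hs
  have ht' : t⁻¹ = t := inv_eq_of_mul_eq_one_right ht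
  have hts : t * s = (s * t)⁻¹ := by rw [mul_inv_rev, hs', ht']
  rcases Nat.even_or_odd k with ⟨m, hm⟩ | ⟨m, hm⟩
  · obtain rfl : k = 2 * m := by omega
    rw [altProd_two_mul, altProd_two_mul, hts, inv_pow]
    rw [show 2 * m = m + m from by ring, pow_add] at h
    exact (inv_eq_of_mul_eq_one_right h).symm
  · obtain rfl : k = 2 * m + 1 := by omega
    rw [altProd_two_mul_add_one, altProd_two_mul_add_one, hts, inv_pow]
    rw [show 2 * m + 1 = m + (m + 1) from by ring, pow_add, pow_succ] at h
    rw [inv_eq_of_mul_eq_one_right h, mul_assoc, mul_assoc, ht, mul_one]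

lemma map_altProd {G H : Type*} [Monoid G] [Monoid H] (φ : G →* H) (x y : G) (n : ℕ) :
    φ (altProd x y n) = altProd (φ x) (φ y) n := by
  induction n generalizing x y with
  | zero => simp [altProd]
  | succ m ih => simp [altProd, ih]

/-- The first `n` terms of `s` satisfy the braid relations. -/
structure IsBraidSeq {G : Type*} [Monoid G] (s : ℕ → G) (n : ℕ) : Prop where
  comm : ∀ i j, i + 2 ≤ j → j < n → Commute (s i) (s j)
  braid : ∀ i, i + 1 < n → s i * s (i + 1) * s i = s (i + 1) * s i * s (i + 1)

/-- The product, in increasing order, of the `s i` with `i < n` and `i ≡ p` modulo `2`. -/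
def parityProd {G : Type*} [Monoid G] (s : ℕ → G) (p : ℕ) : ℕ → G
  | 0 => 1
  | n + 1 => parityProd s p n * if n % 2 = p % 2 then s n else 1

/-- The descending product `s (t + l - 1) * ⋯ * s (t + 1) * s t`. -/
def descProd {G : Type*} [Monoid G] (s : ℕ → G) (t : ℕ) : ℕ → G
  | 0 => 1
  | l + 1 => descProd s (t + 1) l * s t

section BraidSeq

variable {G : Type*} [Monoid G] {s : ℕ → G}

lemma IsBraidSeq.mono {m n : ℕ} (h : IsBraidSeq s n) (hmn : m ≤ n) : IsBraidSeq s m :=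
  ⟨fun i j hij hj => h.comm i j hij (by omega), fun i hi => h.braid i (by omega)⟩

lemma parityProd_congr {p q : ℕ} (hpq : p % 2 = q % 2) (n : ℕ) :
    parityProd s p n = parityProd s q n := by
  induction n with
  | zero => rfl
  | succ n ih => simp only [parityProd, ih, hpq]

lemma parityProd_succ_of_eq {p n : ℕ} (h : n % 2 = p % 2) :
    parityProd s p (n + 1) = parityProd s p n * s n := by
  simp [parityProd, h]

lemma parityProd_succ_of_ne {p n : ℕ} (h : n % 2 ≠ p % 2) :
    parityProd s p (n + 1) = parityProd s p n := by
  simp [parityProd, h]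

lemma altProd_parityProd_succ (p n l : ℕ) :
    altProd (parityProd s p n) (parityProd s (p + 1) n) (l + 1) =
      altProd (parityProd s p n) (parityProd s (p + 1) n) l * parityProd s (p + l) n := by
  induction l generalizing p with
  | zero => simp [altProd]
  | succ l ih =>
    have h := ih (p + 1)
    rw [parityProd_congr (show (p + 1 + 1) % 2 = p % 2 by omega)] at h
    rw [altProd, h, altProd, mul_assoc, show p + 1 + l = p + (l + 1) by omega]

lemma IsBraidSeq.commute_parityProd {n : ℕ} (h : IsBraidSeq s n) (p : ℕ) {m j : ℕ}
    (hmj : m + 1 ≤ j) (hj : j < n) : Commute (parityProd s p m) (s j) := by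
  induction m with
  | zero => exact Commute.one_left _
  | succ m ih =>
    rw [parityProd]
    refine (ih (by omega)).mul_left ?_
    split_ifs
    · exact h.comm m j (by omega) hj
    · exact Commute.one_left _

lemma IsBraidSeq.commute_descProd {n : ℕ} (h : IsBraidSeq s n) {i t l : ℕ}
    (hit : i + 2 ≤ t) (hl : t + l ≤ n) : Commute (s i) (descProd s t l) := by
  induction l generalizing t with
  | zero => exact Commute.one_right _
  | succ l ih => exact (ih (by omega) (by omega)).mul_right (h.comm i t hit (by omega))

lemma IsBraidSeq.parityProd_commute_descProd {n : ℕ} (h : IsBraidSeq s n) (p : ℕ) {m t l : ℕ}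
    (hmt : m + 1 ≤ t) (hl : t + l ≤ n) : Commute (parityProd s p m) (descProd s t l) := by
  induction l generalizing t with
  | zero => exact Commute.one_right _
  | succ l ih =>
    exact (ih (by omega) (by omega)).mul_right (h.commute_parityProd p hmt (by omega))

lemma IsBraidSeq.descProd_mul {n : ℕ} (h : IsBraidSeq s n) {i t l : ℕ}
    (hti : t ≤ i) (hil : i + 1 < t + l) (hl : t + l ≤ n) :
    descProd s t l * s (i + 1) = s i * descProd s t l := by
  induction l generalizing t with
  | zero => omega
  | succ l ih =>
    rcases hti.eq_or_lt with rfl | hlt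
    · obtain ⟨l, rfl⟩ : ∃ l', l = l' + 1 := ⟨l - 1, by omega⟩
      have hc := h.commute_descProd (i := t) (t := t + 2) (l := l) le_rfl (by omega)
      have hb := h.braid t (by omega)
      simp only [descProd]
      calc descProd s (t + 2) l * s (t + 1) * s t * s (t + 1)
          = descProd s (t + 2) l * (s (t + 1) * s t * s (t + 1)) := by simp only [mul_assoc]
        _ = descProd s (t + 2) l * s t * (s (t + 1) * s t) := by
          rw [← hb]; simp only [mul_assoc]
        _ = s t * (descProd s (t + 2) l * s (t + 1) * s t) := by
          rw [← hc.eq]; simp only [mul_assoc]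
    · rw [descProd, mul_assoc, (h.comm t (i + 1) (by omega) (by omega)).eq, ← mul_assoc,
        ih (by omega) (by omega) (by omega), mul_assoc]

/-- Moving a descending product to the right past one layer of generators. -/
lemma IsBraidSeq.parityProd_mul_descProd_mul {n : ℕ} (h : IsBraidSeq s n) {t l u : ℕ}
    (hul : u < l) (hl : t + 1 + l ≤ n) :
    parityProd s (t + 1) (t + 1) * descProd s (t + 1) l * parityProd s t (t + 1 + u + 1) =
      parityProd s (t + 1) (t + 1 + u) * (parityProd s t t * descProd s t (l + 1)) := by
  induction u with
  | zero =>
    have hc := h.parityProd_commute_descProd t (m := t) (t := t + 1) (l := l) le_rfl hl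
    rw [add_zero, parityProd_succ_of_ne (p := t) (n := t + 1) (by omega),
      parityProd_succ_of_eq (p := t) (n := t) rfl, descProd, mul_assoc,
      ← mul_assoc (descProd s (t + 1) l), ← hc.eq, mul_assoc]
  | succ u ih =>
    specialize ih (by omega)
    rw [← add_assoc]
    by_cases hpar : (t + 1 + u + 1) % 2 = t % 2
    · rw [parityProd_succ_of_eq hpar, ← mul_assoc, ih,
        parityProd_succ_of_eq (p := t + 1) (n := t + 1 + u) (by omega), mul_assoc, mul_assoc,
        h.descProd_mul (by omega) (by omega) (by omega), ← mul_assoc (parityProd s t t),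
        (h.commute_parityProd t (m := t) (j := t + 1 + u) (by omega) (by omega)).eq]
      simp only [mul_assoc]
    · rw [parityProd_succ_of_ne hpar, ih,
        parityProd_succ_of_ne (p := t + 1) (n := t + 1 + u) (by omega)]

lemma IsBraidSeq.descProd_mul_parityProd {n : ℕ} (h : IsBraidSeq s (n + 1)) {u : ℕ} (hu : u ≤ n) :
    descProd s 0 (n + 1) * parityProd s 1 (u + 1) =
      parityProd s 0 u * descProd s 0 (n + 1) := by
  induction u with
  | zero => simp [parityProd]
  | succ u ih =>
    by_cases hpar : u % 2 = 0
    · rw [parityProd_succ_of_eq (p := 1) (n := u + 1) (by omega),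
        parityProd_succ_of_eq (p := 0) (n := u) (by omega), ← mul_assoc, ih (by omega), mul_assoc,
        h.descProd_mul (by omega) (by omega) (by omega), mul_assoc]
    · rw [parityProd_succ_of_ne (p := 1) (n := u + 1) (by omega),
        parityProd_succ_of_ne (p := 0) (n := u) (by omega), ih (by omega)]

/-- Peeling the last generator off the first `j + 1` layers, the first of which contains it. -/
lemma IsBraidSeq.altProd_parityProd_peel {n : ℕ} (h : IsBraidSeq s (n + 1)) {j t : ℕ}
    (hj : t + j = n) :
    altProd (parityProd s n (n + 1)) (parityProd s (n + 1) (n + 1)) (j + 1) =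
      altProd (parityProd s n n) (parityProd s (n + 1) n) j *
        (parityProd s t t * descProd s t (j + 1)) := by
  induction j generalizing t with
  | zero =>
    obtain rfl : t = n := by omega
    simp [altProd, descProd, parityProd_succ_of_eq]
  | succ j ih =>
    have hstep := h.parityProd_mul_descProd_mul (t := t) (l := j + 1) (u := j) (by omega) (by omega)
    rw [show t + 1 + j = n by omega] at hstep
    rw [altProd_parityProd_succ, ih (t := t + 1) (by omega), altProd_parityProd_succ n n j,
      parityProd_congr (show (n + (j + 1)) % 2 = t % 2 by omega),
      parityProd_congr (show (n + j) % 2 = (t + 1) % 2 by omega), mul_assoc, hstep, mul_assoc]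

/-- The two alternating products of the odd and even generators of a braid sequence of
length `n`, with `n + 1` factors, agree. -/
theorem IsBraidSeq.altProd_parityProd_comm {n : ℕ} (h : IsBraidSeq s n) :
    altProd (parityProd s n n) (parityProd s (n + 1) n) (n + 1) =
      altProd (parityProd s (n + 1) n) (parityProd s n n) (n + 1) := by
  induction n with
  | zero => rfl
  | succ n ih =>
    have hpeel := h.altProd_parityProd_peel (j := n) (t := 0) (by omega)
    rw [parityProd, one_mul] at hpeel
    have hP : altProd (parityProd s n (n + 1)) (parityProd s (n + 1) (n + 1)) (n + 2) =
        altProd (parityProd s n n) (parityProd s (n + 1) n) (n + 1) * descProd s 0 (n + 1) := by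
      rw [altProd_parityProd_succ, hpeel, altProd_parityProd_succ n n n,
        parityProd_congr (show (n + (n + 1)) % 2 = 1 % 2 by omega),
        parityProd_congr (show (n + n) % 2 = 0 % 2 by omega), mul_assoc,
        h.descProd_mul_parityProd le_rfl, mul_assoc]
    have hQ : altProd (parityProd s (n + 1) (n + 1)) (parityProd s n (n + 1)) (n + 2) =
        altProd (parityProd s (n + 1) n) (parityProd s n n) (n + 1) * descProd s 0 (n + 1) := by
      rw [altProd, hpeel, altProd, parityProd_succ_of_ne (p := n + 1) (n := n) (by omega),
        mul_assoc]
    rw [parityProd_congr (show (n + 1 + 1) % 2 = n % 2 by omega), hP, hQ,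
      ih (h.mono (by omega))]

lemma prod_finRange_eq_parityProd {p : ℕ} (hp : p < 2) (r : ℕ) :
    ((List.finRange r).map fun i => s (2 * i.1 + p)).prod = parityProd s p (2 * r) := by
  induction r with
  | zero => simp [parityProd]
  | succ r ih =>
    rw [List.finRange_succ_last, List.map_append, List.prod_append, List.map_map,
      show 2 * (r + 1) = 2 * r + 1 + 1 by omega, parityProd, parityProd, ← ih]
    obtain rfl | rfl : p = 0 ∨ p = 1 := by omega
    · simp [Function.comp_def, Nat.add_mod]
    · simp [Function.comp_def, Nat.add_mod]

end BraidSeq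

/-- The generators of the braid group, extended by `1` to all natural numbers. -/
def braidSeq (m i : ℕ) : BraidGroup m := if h : i < m - 1 then σ ⟨i, h⟩ else 1

lemma braidSeq_of_lt {m i : ℕ} (h : i < m - 1) : braidSeq m i = σ ⟨i, h⟩ := dif_pos h

lemma isBraidSeq_braidSeq (m : ℕ) : IsBraidSeq (braidSeq m) (m - 1) where
  comm i j hij hj := by
    have hi : i < m - 1 := by omega
    rw [braidSeq_of_lt hi, braidSeq_of_lt hj]
    have h := PresentedGroup.one_of_mem (rels := braidRels m)
      (Or.inl ⟨⟨i, hi⟩, ⟨j, hj⟩, hij, rfl⟩)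
    simp only [map_mul, map_inv] at h
    exact mul_inv_eq_iff_eq_mul.mp (mul_inv_eq_one.mp h)
  braid i hj := by
    have hi : i < m - 1 := by omega
    rw [braidSeq_of_lt hi, braidSeq_of_lt hj]
    have h := PresentedGroup.one_of_mem (rels := braidRels m)
      (Or.inr ⟨⟨i, hi⟩, ⟨i + 1, hj⟩, rfl, rfl⟩)
    rw [map_mul, map_inv] at h
    have h := mul_inv_eq_one.mp h
    simp only [map_mul] at h
    exact h

/-- Let `k ≥ 3` be odd. In the braid group `B_k`, with
`a = σ₂ σ₄ ⋯ σ_{k-1}` and `b = σ₁ σ₃ ⋯ σ_{k-2}`, the two alternating products of `a`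
and `b` with `k` factors agree: `a b a b ⋯ a = b a b a ⋯ b`. -/
theorem braidk_I2_odd_relation (k : ℕ) (hk : 3 ≤ k) (hkodd : k % 2 = 1) :
    ∀ a b : BraidGroup k,
      a = ((List.finRange ((k - 1) / 2)).map fun i =>
          σ (m := k) ⟨2 * i.1 + 1, by have := i.isLt; omega⟩).prod →
      b = ((List.finRange ((k - 1) / 2)).map fun i =>
          σ (m := k) ⟨2 * i.1, by have := i.isLt; omega⟩).prod →
      altProd a b k = altProd b a k := by
  rintro a b rfl rfl
  have hlen : 2 * ((k - 1) / 2) = k - 1 := by omega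
  have ha := prod_finRange_eq_parityProd (s := braidSeq k) one_lt_two ((k - 1) / 2)
  have hb := prod_finRange_eq_parityProd (s := braidSeq k) zero_lt_two ((k - 1) / 2)
  rw [hlen, funext fun i : Fin ((k - 1) / 2) =>
    braidSeq_of_lt (m := k) (i := 2 * i.1 + 1) (by omega)] at ha
  rw [hlen, funext fun i : Fin ((k - 1) / 2) =>
    braidSeq_of_lt (m := k) (i := 2 * i.1 + 0) (by omega)] at hb
  have h := (isBraidSeq_braidSeq k).altProd_parityProd_comm
  rw [Nat.sub_add_cancel (by omega : 1 ≤ k),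
    parityProd_congr (show (k - 1) % 2 = 0 % 2 by omega),
    parityProd_congr (show k % 2 = 1 % 2 by omega), ← ha, ← hb] at h
  exact h.symm
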